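/- Let T be a set of L-sentences and φ a coherent L-formula with free variables among x₁,…,xₙ. Then the projection π₁ : D_φ → M_T is a local homeomorphism with respect to the logical topologies. -/

import Mathlib

open FirstOrder Language Set Topology TopologicalSpace Cardinal

universe u v w

namespace SemGpd

variable (L : FirstOrder.Language.{u, v}) (S : Type w)

/-- An `S`-indexed `L`-structure: a subset `A ⊆ S`, an equivalence relation `≈` on `A`,
and an `L`-structure on the quotient `A/≈`. -/
structure IndexedStructure where
  A : Set S
  r : Setoid A
  str : L.Structure (Quotient r)

variable {L S}

/-- The underlying set (carrier) `A/≈` of an indexed structure. -/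
abbrev IndexedStructure.carrier (M : IndexedStructure L S) : Type w := Quotient M.r

/-- The equivalence class of an indexed element. -/
def IndexedStructure.cls (M : IndexedStructure L S) (a : S) (h : a ∈ M.A) : M.carrier :=
  Quotient.mk M.r ⟨a, h⟩

/-- Satisfaction of a formula in an indexed structure under an assignment. -/
def IndexedStructure.Sat (M : IndexedStructure L S) {α : Type*} (φ : L.Formula α)
    (v : α → M.carrier) : Prop :=
  letI := M.str
  φ.Realize v

/-- Satisfaction of a sentence in an indexed structure. -/
def IndexedStructure.SatSentence (M : IndexedStructure L S) (σ : L.Sentence) : Prop :=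
  letI := M.str
  M.carrier ⊨ σ

/-- `M` is an `S`-indexed model of the theory `T`. -/
def IndexedStructure.models (M : IndexedStructure L S) (T : Set L.Sentence) : Prop :=
  ∀ σ ∈ T, M.SatSentence σ

variable (L S)

/-- The basic set `⟨φ, a⟩` of indexed structures. -/
def fSet {n : ℕ} (φ : L.Formula (Fin n)) (a : Fin n → S) : Set (IndexedStructure L S) :=
  {M | ∃ h : ∀ i, a i ∈ M.A, M.Sat φ fun i => M.cls (a i) (h i)}

/-- The basic set `⟨a⟩` of structures in which `a` is indexed. -/
def membSet (a : S) : Set (IndexedStructure L S) :=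
  {M | a ∈ M.A}

/-- The logical topology on the space of `S`-indexed `L`-structures, generated by the
membership conditions `⟨a⟩` and the atomic conditions `⟨φ, a⟩` for `φ` atomic (which include
the relation conditions `⟨R,a⟩`, the function conditions `⟨f(a)=b⟩` and equality conditions). -/
def logicalTopology : TopologicalSpace (IndexedStructure L S) :=
  generateFrom {U | (∃ a : S, U = membSet L S a) ∨
    ∃ (n : ℕ) (φ : L.Formula (Fin n)), BoundedFormula.IsAtomic φ ∧
      ∃ a : Fin n → S, U = fSet L S φ a}

instance : TopologicalSpace (IndexedStructure L S) := logicalTopology L S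

/-- An isomorphism between `S`-indexed `L`-structures. -/
structure IndexedIso where
  dom : IndexedStructure L S
  cod : IndexedStructure L S
  iso : @Language.Equiv L dom.carrier cod.carrier dom.str cod.str

variable {L S}

/-- Application of an isomorphism of indexed structures to an element of the domain. -/
def IndexedIso.map (F : IndexedIso L S) (x : F.dom.carrier) : F.cod.carrier :=
  (@Language.Equiv.toEquiv L F.dom.carrier F.cod.carrier F.dom.str F.cod.str F.iso) x

/-- The basic set `⟨a ↦ b⟩` of isomorphisms. -/
def mapSet (a b : S) : Set (IndexedIso L S) :=
  {F | ∃ (ha : a ∈ F.dom.A) (hb : b ∈ F.cod.A),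
    F.map (F.dom.cls a ha) = F.cod.cls b hb}

variable (L S)

/-- The logical topology on the space of isomorphisms of `S`-indexed `L`-structures:
the coarsest topology making `dom` and `cod` continuous and containing each `⟨a ↦ b⟩`. -/
def isoTopology : TopologicalSpace (IndexedIso L S) :=
  ((logicalTopology L S).induced IndexedIso.dom) ⊓
    ((logicalTopology L S).induced IndexedIso.cod) ⊓
    generateFrom {V | ∃ a b : S, V = mapSet a b}

instance : TopologicalSpace (IndexedIso L S) := isoTopology L S

variable {L S}

/-- The identity isomorphism. -/
def idIso (M : IndexedStructure L S) : IndexedIso L S :=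
  ⟨M, M, by letI := M.str; exact Language.Equiv.refl L M.carrier⟩

/-- The inverse of an isomorphism of indexed structures. -/
def IndexedIso.inv (F : IndexedIso L S) : IndexedIso L S :=
  ⟨F.cod, F.dom, by letI := F.dom.str; letI := F.cod.str; exact F.iso.symm⟩

/-- The composite of two composable isomorphisms of indexed structures. -/
def IndexedIso.comp (F G : IndexedIso L S) (h : F.cod = G.dom) : IndexedIso L S :=
  ⟨F.dom, G.cod, by
    letI := F.dom.str; letI := F.cod.str; letI := G.cod.str
    exact Language.Equiv.comp (by rw [h]; exact G.iso) F.iso⟩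

variable (L S)

/-- The space of composable pairs of isomorphisms, as a subspace of the product. -/
def CompPairs := {p : IndexedIso L S × IndexedIso L S // p.1.cod = p.2.dom}

instance : TopologicalSpace (CompPairs L S) :=
  instTopologicalSpaceSubtype

/-- The space `M_T` of `S`-indexed models of `T`, as a subspace of `M_L`. -/
abbrev ModelsT (T : Set L.Sentence) := {M : IndexedStructure L S // M.models T}

/-- The space `I_T` of isomorphisms between `S`-indexed models of `T`, as a subspace of `I_L`. -/
abbrev IsoT (T : Set L.Sentence) := {F : IndexedIso L S // F.dom.models T ∧ F.cod.models T}

variable {L S}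

/-- The domain map `d : I_T → M_T`. -/
def IsoT.d {T : Set L.Sentence} (F : IsoT L S T) : ModelsT L S T := ⟨F.1.dom, F.2.1⟩

/-- The codomain map `c : I_T → M_T`. -/
def IsoT.c {T : Set L.Sentence} (F : IsoT L S T) : ModelsT L S T := ⟨F.1.cod, F.2.2⟩

/-- Horn formulas: finite conjunctions of atomic formulas (including `⊤`). -/
inductive IsHorn {α : Type*} : ∀ {n : ℕ}, L.BoundedFormula α n → Prop
  | top {n : ℕ} : IsHorn (⊤ : L.BoundedFormula α n)
  | equal {n : ℕ} (t₁ t₂ : L.Term (α ⊕ Fin n)) : IsHorn (t₁.bdEqual t₂)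
  | rel {n k : ℕ} (R : L.Relations k) (ts : Fin k → L.Term (α ⊕ Fin n)) :
      IsHorn (R.boundedFormula ts)
  | inf {n : ℕ} {φ ψ : L.BoundedFormula α n} : IsHorn φ → IsHorn ψ → IsHorn (φ ⊓ ψ)

/-- Coherent formulas: built from atomic formulas, `⊤` and `⊥` by `∧`, `∨` and `∃`. -/
inductive IsCoherent {α : Type*} : ∀ {n : ℕ}, L.BoundedFormula α n → Prop
  | falsum {n : ℕ} : IsCoherent (⊥ : L.BoundedFormula α n)
  | top {n : ℕ} : IsCoherent (⊤ : L.BoundedFormula α n)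
  | equal {n : ℕ} (t₁ t₂ : L.Term (α ⊕ Fin n)) : IsCoherent (t₁.bdEqual t₂)
  | rel {n k : ℕ} (R : L.Relations k) (ts : Fin k → L.Term (α ⊕ Fin n)) :
      IsCoherent (R.boundedFormula ts)
  | inf {n : ℕ} {φ ψ : L.BoundedFormula α n} : IsCoherent φ → IsCoherent ψ → IsCoherent (φ ⊓ ψ)
  | sup {n : ℕ} {φ ψ : L.BoundedFormula α n} : IsCoherent φ → IsCoherent ψ → IsCoherent (φ ⊔ ψ)
  | ex {n : ℕ} {φ : L.BoundedFormula α (n + 1)} : IsCoherent φ → IsCoherent φ.ex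

/-- A coherent sequent: a sentence of the form `∀ x₁ … xₙ (φ → ψ)` with `φ, ψ` coherent. -/
def IsCoherentSequent (σ : L.Sentence) : Prop :=
  ∃ (n : ℕ) (φ ψ : L.BoundedFormula Empty n),
    IsCoherent φ ∧ IsCoherent ψ ∧ σ = (φ.imp ψ).alls


variable (L S)

/-- The sheaf `D_φ` of realizations of `φ` over the space of `S`-indexed models of `T`. -/
structure DSet (T : Set L.Sentence) {n : ℕ} (φ : L.Formula (Fin n)) where
  str : IndexedStructure L S
  mods : str.models T
  tup : Fin n → str.carrier
  sat : str.Sat φ tup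

variable {L S}

/-- The projection `π₁ : D_φ → M_T`. -/
def DSet.pi {T : Set L.Sentence} {n : ℕ} {φ : L.Formula (Fin n)} (d : DSet L S T φ) :
    ModelsT L S T := ⟨d.str, d.mods⟩

variable (L S)

/-- The image of the section `s_a : ⟨φ,a⟩ ∩ M_T → D_φ`. -/
def secImage (T : Set L.Sentence) {n : ℕ} (φ : L.Formula (Fin n)) (a : Fin n → S) :
    Set (DSet L S T φ) :=
  {d | ∃ h : ∀ i, a i ∈ d.str.A, d.tup = fun i => d.str.cls (a i) (h i)}

/-- The logical topology on `D_φ`: the coarsest topology making `π₁` continuous and making the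
image of every section `s_a` open. -/
def dTopology (T : Set L.Sentence) {n : ℕ} (φ : L.Formula (Fin n)) :
    TopologicalSpace (DSet L S T φ) :=
  (TopologicalSpace.induced DSet.pi inferInstance) ⊓
    generateFrom {V | ∃ a : Fin n → S, V = secImage L S T φ a}

instance {T : Set L.Sentence} {n : ℕ} {φ : L.Formula (Fin n)} :
    TopologicalSpace (DSet L S T φ) := dTopology L S T φ

/-- The basic open set `⟨ψ, b⟩` of `D_φ`. -/
def dBasic (T : Set L.Sentence) {n : ℕ} (φ : L.Formula (Fin n)) {m : ℕ}
    (ψ : L.Formula (Fin n ⊕ Fin m)) (b : Fin m → S) : Set (DSet L S T φ) :=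
  {d | ∃ h : ∀ j, b j ∈ d.str.A,
    d.str.Sat ψ (Sum.elim d.tup fun j => d.str.cls (b j) (h j))}

/-- The fiber product `I_T ×_{M_T} D_φ` of composable pairs for the application action. -/
def ActPairs (T : Set L.Sentence) {n : ℕ} (φ : L.Formula (Fin n)) :=
  {p : IsoT L S T × DSet L S T φ // p.1.1.dom = p.2.str}

instance {T : Set L.Sentence} {n : ℕ} {φ : L.Formula (Fin n)} :
    TopologicalSpace (ActPairs L S T φ) := instTopologicalSpaceSubtype

variable {L S}

/-- Isomorphisms of indexed structures preserve satisfaction. -/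
theorem IndexedIso.sat_map (F : IndexedIso L S) {α : Type*} (φ : L.Formula α)
    (v : α → F.dom.carrier) (h : F.dom.Sat φ v) :
    F.cod.Sat φ fun i => F.map (v i) := by
  letI := F.dom.str
  letI := F.cod.str
  have := (StrongHomClass.realize_formula (F.iso) φ (v := v)).mpr h
  exact this

/-- Transport of satisfaction along an equality of indexed structures. -/
theorem sat_cast {M N : IndexedStructure L S} (h : M = N) {α : Type*} (φ : L.Formula α)
    (v : α → N.carrier) (hs : N.Sat φ v) :
    M.Sat φ fun i => cast (congrArg IndexedStructure.carrier h.symm) (v i) := by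
  subst h; exact hs

/-- The application action `θ : I_T ×_{M_T} D_φ → D_φ`. -/
def act {T : Set L.Sentence} {n : ℕ} {φ : L.Formula (Fin n)} (p : ActPairs L S T φ) :
    DSet L S T φ where
  str := p.1.1.1.cod
  mods := p.1.1.2.2
  tup := fun i =>
    p.1.1.1.map (cast (congrArg IndexedStructure.carrier p.2.symm) (p.1.2.tup i))
  sat := p.1.1.1.sat_map φ _ (sat_cast p.2 φ p.1.2.tup p.1.2.sat)

/-- A subset of `D_φ` is stable if it is closed under the application action. -/
def Stable {T : Set L.Sentence} {n : ℕ} {φ : L.Formula (Fin n)}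
    (X : Set (DSet L S T φ)) : Prop :=
  ∀ p : ActPairs L S T φ, p.1.2 ∈ X → act p ∈ X

/-- The stabilization of a subset of `D_φ`: the smallest stable subset containing it. -/
def stabilization {T : Set L.Sentence} {n : ℕ} {φ : L.Formula (Fin n)}
    (X : Set (DSet L S T φ)) : Set (DSet L S T φ) :=
  ⋂₀ {Y | X ⊆ Y ∧ Stable Y}

/-- The set `{(M,m) ∈ D_φ : M ⊨ ∃y ψ(m,y)}`. -/
def exSet {T : Set L.Sentence} {n : ℕ} (φ : L.Formula (Fin n)) {m : ℕ}
    (ψ : L.Formula (Fin n ⊕ Fin m)) : Set (DSet L S T φ) :=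
  {d | ∃ w : Fin m → d.str.carrier, d.str.Sat ψ (Sum.elim d.tup w)}

/-- The identity isomorphism on a model of `T`, as an element of `I_T`. -/
def idIsoT {T : Set L.Sentence} (M : ModelsT L S T) : IsoT L S T :=
  ⟨idIso M.1, M.2, M.2⟩

/-- The inverse, in `I_T`. -/
def IsoT.inv {T : Set L.Sentence} (F : IsoT L S T) : IsoT L S T :=
  ⟨F.1.inv, F.2.2, F.2.1⟩

/-- The composite, in `I_T`. -/
def IsoT.comp {T : Set L.Sentence} (F G : IsoT L S T) (h : F.1.cod = G.1.dom) : IsoT L S T :=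
  ⟨F.1.comp G.1 h, F.2.1, G.2.2⟩



variable {L : FirstOrder.Language.{u, v}} {S : Type w}

/-- The set `⟨φ, a, b⟩` for a formula `φ` with free variables interpreted by `a` and bound-level
variables interpreted by `b`. -/
def boundedSet {n k : ℕ} (φ : L.BoundedFormula (Fin n) k) (a : Fin n → S) (b : Fin k → S) :
    Set (IndexedStructure L S) :=
  {M | ∃ (ha : ∀ i, a i ∈ M.A) (hb : ∀ j, b j ∈ M.A),
    @BoundedFormula.Realize L M.carrier M.str _ _ φ
      (fun i => M.cls (a i) (ha i)) (fun j => M.cls (b j) (hb j))}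

theorem isOpen_membSet (a : S) : IsOpen (membSet L S a) :=
  isOpen_generateFrom_of_mem (Or.inl ⟨a, rfl⟩)

theorem isOpen_fSet_of_isAtomic {n : ℕ} {φ : L.Formula (Fin n)} (hφ : BoundedFormula.IsAtomic φ)
    (a : Fin n → S) : IsOpen (fSet L S φ a) :=
  isOpen_generateFrom_of_mem (Or.inr ⟨n, φ, hφ, a, rfl⟩)

theorem isOpen_setOf_forall_mem {n : ℕ} (a : Fin n → S) :
    IsOpen {M : IndexedStructure L S | ∀ i, a i ∈ M.A} := by
  rw [ofPred_forall]
  exact isOpen_iInter_of_finite fun i => isOpen_membSet (a i)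

/-- The renaming turning all variables of a bounded formula into free variables. -/
def mergeVars (n k : ℕ) : Fin n ⊕ Fin k → Fin (n + k) ⊕ Fin 0 :=
  fun x => Sum.inl (finSumFinEquiv x)

theorem forall_append_mem_iff {n k : ℕ} (a : Fin n → S) (b : Fin k → S) (A : Set S) :
    (∀ i, Fin.append a b i ∈ A) ↔ (∀ i, a i ∈ A) ∧ ∀ j, b j ∈ A := by
  rw [← finSumFinEquiv.forall_congr_right]
  simp [Sum.forall]

theorem realize_relabel_mergeVars (M : IndexedStructure L S) {n k : ℕ} (a : Fin n → S)
    (b : Fin k → S) (ha : ∀ i, a i ∈ M.A) (hb : ∀ j, b j ∈ M.A)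
    (h : ∀ i, Fin.append a b i ∈ M.A) (xs : Fin 0 → M.carrier) (t : L.Term (Fin n ⊕ Fin k)) :
    @Term.realize L M.carrier M.str _
        (Sum.elim (fun i => M.cls (Fin.append a b i) (h i)) xs)
        (t.relabel (mergeVars n k)) =
      @Term.realize L M.carrier M.str _
        (Sum.elim (fun i => M.cls (a i) (ha i)) (fun j => M.cls (b j) (hb j))) t := by
  let _ := M.str
  rw [Term.realize_relabel]
  congr 1
  funext x
  rcases x with i | j <;> simp [mergeVars]

theorem isOpen_boundedSet_bdEqual {n k : ℕ} (t₁ t₂ : L.Term (Fin n ⊕ Fin k)) (a : Fin n → S)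
    (b : Fin k → S) : IsOpen (boundedSet (t₁.bdEqual t₂) a b) := by
  convert isOpen_fSet_of_isAtomic (BoundedFormula.IsAtomic.equal (t₁.relabel (mergeVars n k))
    (t₂.relabel (mergeVars n k))) (Fin.append a b) using 1
  ext M
  let _ := M.str
  constructor
  · rintro ⟨ha, hb, h⟩
    have hab := (forall_append_mem_iff a b M.A).2 ⟨ha, hb⟩
    refine ⟨hab, ?_⟩
    simp only [IndexedStructure.Sat, Formula.Realize, BoundedFormula.realize_bdEqual] at h ⊢
    rwa [realize_relabel_mergeVars M a b ha hb hab, realize_relabel_mergeVars M a b ha hb hab]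
  · rintro ⟨hab, h⟩
    obtain ⟨ha, hb⟩ := (forall_append_mem_iff a b M.A).1 hab
    refine ⟨ha, hb, ?_⟩
    simp only [IndexedStructure.Sat, Formula.Realize, BoundedFormula.realize_bdEqual] at h ⊢
    rwa [realize_relabel_mergeVars M a b ha hb hab, realize_relabel_mergeVars M a b ha hb hab] at h

theorem isOpen_boundedSet_rel {n k l : ℕ} (R : L.Relations l) (ts : Fin l → L.Term (Fin n ⊕ Fin k))
    (a : Fin n → S) (b : Fin k → S) : IsOpen (boundedSet (R.boundedFormula ts) a b) := by
  convert isOpen_fSet_of_isAtomic (BoundedFormula.IsAtomic.rel R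
    fun i => (ts i).relabel (mergeVars n k)) (Fin.append a b) using 1
  ext M
  let _ := M.str
  constructor
  · rintro ⟨ha, hb, h⟩
    have hab := (forall_append_mem_iff a b M.A).2 ⟨ha, hb⟩
    refine ⟨hab, ?_⟩
    simp only [IndexedStructure.Sat, Formula.Realize, BoundedFormula.realize_rel] at h ⊢
    simpa only [realize_relabel_mergeVars M a b ha hb hab] using h
  · rintro ⟨hab, h⟩
    obtain ⟨ha, hb⟩ := (forall_append_mem_iff a b M.A).1 hab
    refine ⟨ha, hb, ?_⟩
    simp only [IndexedStructure.Sat, Formula.Realize, BoundedFormula.realize_rel] at h ⊢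
    simpa only [realize_relabel_mergeVars M a b ha hb hab] using h

theorem boundedSet_inf {n k : ℕ} (φ ψ : L.BoundedFormula (Fin n) k) (a : Fin n → S)
    (b : Fin k → S) : boundedSet (φ ⊓ ψ) a b = boundedSet φ a b ∩ boundedSet ψ a b := by
  ext M
  let _ := M.str
  constructor
  · rintro ⟨ha, hb, h⟩
    rw [BoundedFormula.realize_inf] at h
    exact ⟨⟨ha, hb, h.1⟩, ⟨ha, hb, h.2⟩⟩
  · rintro ⟨⟨ha, hb, h₁⟩, ⟨_, _, h₂⟩⟩
    exact ⟨ha, hb, BoundedFormula.realize_inf.2 ⟨h₁, h₂⟩⟩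

theorem boundedSet_sup {n k : ℕ} (φ ψ : L.BoundedFormula (Fin n) k) (a : Fin n → S)
    (b : Fin k → S) : boundedSet (φ ⊔ ψ) a b = boundedSet φ a b ∪ boundedSet ψ a b := by
  ext M
  let _ := M.str
  constructor
  · rintro ⟨ha, hb, h⟩
    rw [BoundedFormula.realize_sup] at h
    exact h.imp (fun h => ⟨ha, hb, h⟩) (fun h => ⟨ha, hb, h⟩)
  · rintro (⟨ha, hb, h⟩ | ⟨ha, hb, h⟩)
    · exact ⟨ha, hb, BoundedFormula.realize_sup.2 (Or.inl h)⟩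
    · exact ⟨ha, hb, BoundedFormula.realize_sup.2 (Or.inr h)⟩

theorem cls_snoc (M : IndexedStructure L S) {k : ℕ} (b : Fin k → S) (s : S)
    (hb : ∀ j, b j ∈ M.A) (hs : s ∈ M.A)
    (h : ∀ j, (Fin.snoc b s : Fin (k + 1) → S) j ∈ M.A) :
    (fun j => M.cls ((Fin.snoc b s : Fin (k + 1) → S) j) (h j)) =
      Fin.snoc (fun j => M.cls (b j) (hb j)) (M.cls s hs) := by
  funext j
  refine Fin.lastCases ?_ (fun j => ?_) j <;> simp

theorem boundedSet_ex {n k : ℕ} (φ : L.BoundedFormula (Fin n) (k + 1)) (a : Fin n → S)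
    (b : Fin k → S) :
    boundedSet φ.ex a b = ⋃ s : S, boundedSet φ a (Fin.snoc b s : Fin (k + 1) → S) := by
  ext M
  let _ := M.str
  rw [mem_iUnion]
  constructor
  · rintro ⟨ha, hb, h⟩
    obtain ⟨x, hx⟩ := BoundedFormula.realize_ex.1 h
    obtain ⟨⟨s, hs⟩, rfl⟩ := Quotient.exists_rep x
    have hbs : ∀ j, (Fin.snoc b s : Fin (k + 1) → S) j ∈ M.A := by
      intro j
      refine Fin.lastCases ?_ (fun j => ?_) j <;> simp [hs, hb]
    refine ⟨s, ha, hbs, ?_⟩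
    rw [cls_snoc M b s hb hs hbs]
    exact hx
  · rintro ⟨s, ha, hbs, h⟩
    have hb : ∀ j, b j ∈ M.A := fun j => by simpa using hbs j.castSucc
    have hs : s ∈ M.A := by simpa using hbs (Fin.last k)
    refine ⟨ha, hb, BoundedFormula.realize_ex.2 ⟨M.cls s hs, ?_⟩⟩
    rwa [cls_snoc M b s hb hs hbs] at h

theorem IsCoherent.isOpen_boundedSet {n k : ℕ} {φ : L.BoundedFormula (Fin n) k}
    (hφ : IsCoherent φ) (a : Fin n → S) (b : Fin k → S) : IsOpen (boundedSet φ a b) := by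
  induction hφ with
  | falsum =>
    convert isOpen_empty
    exact eq_empty_of_forall_notMem fun M ⟨_, _, h⟩ => h
  | top =>
    convert (isOpen_setOf_forall_mem (L := L) a).inter (isOpen_setOf_forall_mem b)
    ext M
    exact ⟨fun ⟨ha, hb, _⟩ => ⟨ha, hb⟩, fun ⟨ha, hb⟩ => ⟨ha, hb, fun h => h⟩⟩
  | equal t₁ t₂ => exact isOpen_boundedSet_bdEqual t₁ t₂ a b
  | rel R ts => exact isOpen_boundedSet_rel R ts a b
  | inf _ _ ih₁ ih₂ => rw [boundedSet_inf]; exact (ih₁ b).inter (ih₂ b)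
  | sup _ _ ih₁ ih₂ => rw [boundedSet_sup]; exact (ih₁ b).union (ih₂ b)
  | ex _ ih => rw [boundedSet_ex]; exact isOpen_iUnion fun s => ih _

theorem IsCoherent.isOpen_fSet {n : ℕ} {φ : L.Formula (Fin n)} (hφ : IsCoherent φ)
    (a : Fin n → S) : IsOpen (fSet L S φ a) := by
  convert hφ.isOpen_boundedSet a Fin.elim0
  ext M
  let _ := M.str
  refine exists_congr fun ha => ⟨fun h => ⟨fun j => j.elim0, ?_⟩, fun ⟨_, h⟩ => ?_⟩
  · rw [IndexedStructure.Sat, Formula.Realize] at h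
    convert h
  · rw [IndexedStructure.Sat, Formula.Realize]
    convert h

theorem isOpen_setOf_cls_eq (a b : S) :
    IsOpen {M : IndexedStructure L S | ∃ (ha : a ∈ M.A) (hb : b ∈ M.A),
      M.cls a ha = M.cls b hb} := by
  convert isOpen_boundedSet_bdEqual (L := L) (Term.var (Sum.inl 0)) (Term.var (Sum.inr 0))
    (fun _ : Fin 1 => a) (fun _ : Fin 1 => b)
  ext M
  let _ := M.str
  constructor
  · rintro ⟨ha, hb, h⟩
    exact ⟨fun _ => ha, fun _ => hb, h⟩
  · rintro ⟨ha, hb, h⟩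
    exact ⟨ha 0, hb 0, h⟩

theorem isOpen_setOf_forall_cls_eq {n : ℕ} (a b : Fin n → S) :
    IsOpen {M : IndexedStructure L S | ∀ i, ∃ (ha : a i ∈ M.A) (hb : b i ∈ M.A),
      M.cls (a i) ha = M.cls (b i) hb} := by
  rw [ofPred_forall]
  exact isOpen_iInter_of_finite fun i => isOpen_setOf_cls_eq (a i) (b i)

section SecImage

variable (T : Set L.Sentence) {n : ℕ} (φ : L.Formula (Fin n)) (a : Fin n → S)

theorem isOpen_secImage : IsOpen (secImage L S T φ a) :=
  TopologicalSpace.le_def.1 inf_le_right _ (isOpen_generateFrom_of_mem ⟨a, rfl⟩)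

theorem injOn_pi_secImage : InjOn (DSet.pi : DSet L S T φ → ModelsT L S T)
    (secImage L S T φ a) := by
  rintro ⟨M, hM, x, hx⟩ ⟨(ha : ∀ i, a i ∈ M.A), (h₁ : x = fun i => M.cls (a i) (ha i))⟩
    ⟨N, hN, y, hy⟩ ⟨(hb : ∀ i, a i ∈ N.A), (h₂ : y = fun i => N.cls (a i) (hb i))⟩ h
  obtain rfl : M = N := congrArg Subtype.val h
  subst h₁ h₂
  rfl

theorem image_pi_secImage :
    (DSet.pi : DSet L S T φ → ModelsT L S T) '' secImage L S T φ a =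
      Subtype.val ⁻¹' fSet L S φ a := by
  ext M
  constructor
  · rintro ⟨⟨N, hN, x, hx⟩, ⟨(ha : ∀ i, a i ∈ N.A), (h : x = fun i => N.cls (a i) (ha i))⟩, rfl⟩
    subst h
    exact ⟨ha, hx⟩
  · rintro ⟨ha, h⟩
    exact ⟨⟨M.1, M.2, _, h⟩, ⟨ha, rfl⟩, rfl⟩

theorem isInducing_restrict_pi_secImage :
    IsInducing ((secImage L S T φ a).domRestrict (DSet.pi : DSet L S T φ → ModelsT L S T)) := by
  constructor
  change induced Subtype.val (induced DSet.pi _ ⊓ generateFrom _) =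
    induced (DSet.pi ∘ Subtype.val) _
  rw [induced_inf, induced_compose, inf_eq_left, induced_generateFrom_eq]
  refine le_generateFrom ?_
  rintro _ ⟨_, ⟨b, rfl⟩, rfl⟩
  refine ⟨_, (isOpen_setOf_forall_cls_eq a b).preimage continuous_subtype_val, ?_⟩
  ext ⟨⟨M, hM, x, hx⟩, (ha : ∀ i, a i ∈ M.A), (hxa : x = fun i => M.cls (a i) (ha i))⟩
  subst hxa
  constructor
  · intro h
    exact ⟨fun i => (h i).2.1, funext fun i => (h i).2.2⟩
  · rintro ⟨hb, h⟩ i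
    exact ⟨ha i, hb i, congrFun h i⟩

end SecImage

theorem exists_mem_secImage {T : Set L.Sentence} {n : ℕ} {φ : L.Formula (Fin n)}
    (d : DSet L S T φ) : ∃ a : Fin n → S, d ∈ secImage L S T φ a := by
  choose a ha using fun i => Quotient.exists_rep (d.tup i)
  exact ⟨fun i => (a i).1, fun i => (a i).2, funext fun i => (ha i).symm⟩

theorem stmt10 (T : Set L.Sentence) {n : ℕ} (φ : L.Formula (Fin n)) (hφ : IsCoherent φ) :
    IsLocalHomeomorph (DSet.pi : DSet L S T φ → ModelsT L S T) := by
  rw [isLocalHomeomorph_iff_isOpenEmbedding_restrict]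
  intro d
  obtain ⟨a, ha⟩ := exists_mem_secImage d
  refine ⟨_, (isOpen_secImage T φ a).mem_nhds ha,
    ⟨isInducing_restrict_pi_secImage T φ a, (injOn_pi_secImage T φ a).injective⟩, ?_⟩
  rw [range_domRestrict, image_pi_secImage]
  exact (hφ.isOpen_fSet a).preimage continuous_subtype_val

end SemGpd
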